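/- arXiv:2506.10296 — 2 statements merged into one kernel-verified Lean document; each statement's English description precedes it below -/
import Mathlib

section
/- Let B(x) = max_{i∈[k]} (c_iᵀx − d_i) be a polyhedral function on ℝⁿ, let (A_l, b_l), l ∈ [m], be the modes of a switched affine system, and let λ ≥ 0. For every fixed mode l ∈ [m], the map x ↦ M(x,l) is continuous on ℝⁿ, where M is the merit function M(x,l) = min_{i∈[k]} sup{τ ≥ 0 : τ·c_iᵀ(A_l x + b_l) + (c_iᵀx − d_i) + λτ·(c_iᵀx − d_i) − max_{i'∈[k]}(c_{i'}ᵀx − d_{i'}) ≤ −τ²}. -/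
open Finset Matrix

/-- The polyhedral (pointwise-maximum) function `B(x) = max_{i∈[k]} (cᵢᵀx − dᵢ)`. -/
noncomputable def Bmax {n k : ℕ} [NeZero k] (c : Fin k → Fin n → ℝ) (d : Fin k → ℝ)
    (x : Fin n → ℝ) : ℝ :=
  Finset.univ.sup' Finset.univ_nonempty fun i => c i ⬝ᵥ x - d i

/-- The piecewise merit value
`Mᵢ(x,l) = sup{τ ≥ 0 : τ·φ̂ᵢ + φᵢ + λτ·φᵢ − φ ≤ −τ²}`. -/
noncomputable def meritPiece {n k m : ℕ} [NeZero k] (c : Fin k → Fin n → ℝ) (d : Fin k → ℝ)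
    (A : Fin m → Matrix (Fin n) (Fin n) ℝ) (b : Fin m → Fin n → ℝ) (lam : ℝ)
    (x : Fin n → ℝ) (l : Fin m) (i : Fin k) : ℝ :=
  sSup {τ : ℝ | 0 ≤ τ ∧
    τ * (c i ⬝ᵥ (A l *ᵥ x + b l)) + (c i ⬝ᵥ x - d i) + lam * τ * (c i ⬝ᵥ x - d i)
      - Bmax c d x ≤ -τ ^ 2}

/-- The merit function `M(x,l) = min_{i∈[k]} Mᵢ(x,l)`. -/
noncomputable def merit {n k m : ℕ} [NeZero k] (c : Fin k → Fin n → ℝ) (d : Fin k → ℝ)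
    (A : Fin m → Matrix (Fin n) (Fin n) ℝ) (b : Fin m → Fin n → ℝ) (lam : ℝ)
    (x : Fin n → ℝ) (l : Fin m) : ℝ :=
  Finset.univ.inf' Finset.univ_nonempty fun i => meritPiece c d A b lam x l i

/-- The largest nonnegative solution of `τ² + pτ ≤ q` with `q ≥ 0` is the larger root of the
quadratic. -/
theorem isGreatest_quadratic_le {p q : ℝ} (hq : 0 ≤ q) :
    IsGreatest {τ : ℝ | 0 ≤ τ ∧ τ ^ 2 + p * τ ≤ q} ((-p + √(p ^ 2 + 4 * q)) / 2) := by
  have hs : √(p ^ 2 + 4 * q) ^ 2 = p ^ 2 + 4 * q := Real.sq_sqrt (by positivity)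
  refine ⟨⟨?_, by nlinarith⟩, ?_⟩
  · have : p ≤ √(p ^ 2 + 4 * q) := Real.le_sqrt_of_sq_le (by linarith)
    linarith
  · rintro τ ⟨-, hτ⟩
    have : 2 * τ + p ≤ √(p ^ 2 + 4 * q) := Real.le_sqrt_of_sq_le (by nlinarith)
    linarith

theorem le_Bmax {n k : ℕ} [NeZero k] (c : Fin k → Fin n → ℝ) (d : Fin k → ℝ)
    (x : Fin n → ℝ) (i : Fin k) : c i ⬝ᵥ x - d i ≤ Bmax c d x :=
  Finset.le_sup' (fun i => c i ⬝ᵥ x - d i) (Finset.mem_univ i)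

theorem continuous_Bmax {n k : ℕ} [NeZero k] (c : Fin k → Fin n → ℝ) (d : Fin k → ℝ) :
    Continuous (Bmax c d) :=
  Continuous.finset_sup'_apply _ fun i _ => by fun_prop

/-- Closed form of the piecewise merit value. -/
theorem meritPiece_eq {n k m : ℕ} [NeZero k] (c : Fin k → Fin n → ℝ) (d : Fin k → ℝ)
    (A : Fin m → Matrix (Fin n) (Fin n) ℝ) (b : Fin m → Fin n → ℝ) (lam : ℝ)
    (x : Fin n → ℝ) (l : Fin m) (i : Fin k) :
    meritPiece c d A b lam x l i =
      (-(c i ⬝ᵥ (A l *ᵥ x + b l) + lam * (c i ⬝ᵥ x - d i)) +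
        √((c i ⬝ᵥ (A l *ᵥ x + b l) + lam * (c i ⬝ᵥ x - d i)) ^ 2 +
          4 * (Bmax c d x - (c i ⬝ᵥ x - d i)))) / 2 := by
  rw [← (isGreatest_quadratic_le (sub_nonneg.2 (le_Bmax c d x i))).csSup_eq, meritPiece]
  congr 1
  ext τ
  refine and_congr_right fun _ => ?_
  constructor <;> intro h <;> linarith

theorem continuous_meritPiece {n k m : ℕ} [NeZero k] (c : Fin k → Fin n → ℝ) (d : Fin k → ℝ)
    (A : Fin m → Matrix (Fin n) (Fin n) ℝ) (b : Fin m → Fin n → ℝ) (lam : ℝ)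
    (l : Fin m) (i : Fin k) :
    Continuous fun x : Fin n → ℝ => meritPiece c d A b lam x l i := by
  have := continuous_Bmax c d
  simp only [meritPiece_eq]
  fun_prop

/-- for each fixed mode, the merit function is continuous in the state. -/
theorem merit_continuous {n k m : ℕ} [NeZero k] (c : Fin k → Fin n → ℝ) (d : Fin k → ℝ)
    (A : Fin m → Matrix (Fin n) (Fin n) ℝ) (b : Fin m → Fin n → ℝ)
    (lam : ℝ) (hlam : 0 ≤ lam) (l : Fin m) :
    Continuous fun x : Fin n → ℝ => merit c d A b lam x l :=
  Continuous.finset_inf'_apply _ fun i _ => continuous_meritPiece c d A b lam l i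
end

section
/- Let B(x) = max_{i∈[k]} (c_iᵀx − d_i) be a polyhedral function on ℝⁿ, let (A_l, b_l), l ∈ [m], be the modes of a switched affine system, and let λ ≥ 0. Suppose B satisfies the pointwise controllability condition (C3): for every x ∈ ℝⁿ with B(x) ≤ 0 there exists l ∈ [m] satisfying the decrease condition at x. Then for every x with B(x) ≤ 0, the maximum max_{l∈[m]} M(x,l) is strictly positive, and every maximizer l* of M(x,·) over [m] satisfies the decrease condition at x. -/
open Finset Matrix

/-- Mode l satisfies the decrease condition at x: every active piece of B with
B(x) ≤ 0 strictly decreases along mode l at rate λ. -/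
def Decrease {n k m : ℕ} [NeZero k] (c : Fin k → Fin n → ℝ) (d : Fin k → ℝ)
    (A : Fin m → Matrix (Fin n) (Fin n) ℝ) (b : Fin m → Fin n → ℝ) (lam : ℝ)
    (x : Fin n → ℝ) (l : Fin m) : Prop :=
  ∀ i : Fin k, (Bmax c d x = c i ⬝ᵥ x - d i ∧ Bmax c d x ≤ 0) →
    c i ⬝ᵥ (A l *ᵥ x + b l) < -lam * (c i ⬝ᵥ x - d i)

/-- For `p ≤ β`, the largest `τ ≥ 0` with `τ h + p + lam τ p - β ≤ -τ²` is positive exactly when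
`β = p` forces `h < -lam p`. -/
lemma sSup_quadratic_pos_iff {h p β lam : ℝ} (hp : p ≤ β) :
    0 < sSup {τ : ℝ | 0 ≤ τ ∧ τ * h + p + lam * τ * p - β ≤ -τ ^ 2} ↔
      (β = p → h < -lam * p) := by
  constructor
  · rintro hpos rfl
    by_contra! hge
    refine hpos.not_ge (Real.sSup_nonpos ?_)
    rintro τ ⟨h0, hτ⟩
    nlinarith [mul_nonneg h0 (by linarith : 0 ≤ h + lam * β)]
  · intro hd
    have hbdd : BddAbove {τ : ℝ | 0 ≤ τ ∧ τ * h + p + lam * τ * p - β ≤ -τ ^ 2} := by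
      refine ⟨|h + lam * p| + (β - p) + 1, ?_⟩
      rintro τ ⟨h0, hτ⟩
      by_contra! hlt
      have ha := neg_abs_le (h + lam * p)
      have hb := abs_nonneg (h + lam * p)
      nlinarith [mul_nonneg h0 (by linarith : 0 ≤ h + lam * p + |h + lam * p|),
        mul_nonneg h0 (by linarith : 0 ≤ τ - (|h + lam * p| + (β - p) + 1)),
        mul_nonneg (by linarith : 0 ≤ τ - 1) (sub_nonneg.2 hp)]
    obtain ⟨τ, hτ0, hτ⟩ : ∃ τ : ℝ, 0 < τ ∧ τ * h + p + lam * τ * p - β ≤ -τ ^ 2 := by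
      rcases hp.eq_or_lt with rfl | hlt
      · exact ⟨-(h + lam * p), by linarith [hd rfl], by nlinarith⟩
      · have hb := abs_nonneg (h + lam * p)
        have hgap : 0 < (β - p) / (|h + lam * p| + 1) := by
          have := sub_pos.2 hlt
          positivity
        refine ⟨min 1 ((β - p) / (|h + lam * p| + 1)), lt_min one_pos hgap, ?_⟩
        have h1 := min_le_left 1 ((β - p) / (|h + lam * p| + 1))
        have h2 := min_le_right 1 ((β - p) / (|h + lam * p| + 1))
        have h0 := lt_min one_pos hgap
        generalize min 1 ((β - p) / (|h + lam * p| + 1)) = τ at h0 h1 h2 ⊢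
        rw [le_div_iff₀ (by positivity)] at h2
        nlinarith [mul_le_mul_of_nonneg_left (le_abs_self (h + lam * p)) h0.le,
          mul_le_mul_of_nonneg_left h1 h0.le]
    exact hτ0.trans_le (le_csSup hbdd ⟨hτ0.le, hτ⟩)

/-- On `B ≤ 0`, a mode has positive merit exactly when it satisfies the decrease condition. -/
lemma merit_pos_iff_decrease {n k m : ℕ} [NeZero k] (c : Fin k → Fin n → ℝ) (d : Fin k → ℝ)
    (A : Fin m → Matrix (Fin n) (Fin n) ℝ) (b : Fin m → Fin n → ℝ) (lam : ℝ)
    {x : Fin n → ℝ} (hx : Bmax c d x ≤ 0) (l : Fin m) :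
    0 < merit c d A b lam x l ↔ Decrease c d A b lam x l := by
  simp only [merit, Finset.lt_inf'_iff, Finset.mem_univ, true_imp_iff, Decrease, hx, and_true]
  exact forall_congr' fun i => sSup_quadratic_pos_iff
    (Finset.le_sup' (fun i => c i ⬝ᵥ x - d i) (Finset.mem_univ i))

/-- under condition (C3), for every x with B(x) ≤ 0 the maximal merit over
modes is strictly positive, and every maximizer of the merit satisfies the decrease
condition at x. -/
theorem argmax_merit_decrease {n k m : ℕ} [NeZero k] [NeZero m]
    (c : Fin k → Fin n → ℝ) (d : Fin k → ℝ)
    (A : Fin m → Matrix (Fin n) (Fin n) ℝ) (b : Fin m → Fin n → ℝ)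
    (lam : ℝ) (hlam : 0 ≤ lam)
    (hC3 : ∀ x : Fin n → ℝ, Bmax c d x ≤ 0 → ∃ l : Fin m, Decrease c d A b lam x l) :
    ∀ x : Fin n → ℝ, Bmax c d x ≤ 0 →
      (0 < Finset.univ.sup' Finset.univ_nonempty (fun l => merit c d A b lam x l)) ∧
      ∀ lstar : Fin m,
        (∀ l' : Fin m, merit c d A b lam x l' ≤ merit c d A b lam x lstar) →
        Decrease c d A b lam x lstar := by
  intro x hx
  obtain ⟨l, hl⟩ := hC3 x hx
  rw [← merit_pos_iff_decrease c d A b lam hx] at hl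
  refine ⟨hl.trans_le (Finset.le_sup' _ (Finset.mem_univ l)), fun lstar hmax => ?_⟩
  rw [← merit_pos_iff_decrease c d A b lam hx]
  exact hl.trans_le (hmax l)
end
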